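/- arXiv:2209.03029 — 3 statements merged into one kernel-verified Lean document; each statement's English description precedes it below -/
import Mathlib

section
/- Let δ > -1, c = 0 and k < -1 be real numbers. Define, for 0 ≤ ρ < 1, I₁(ρ) = ∫₀¹ (1-r)^δ (1-rρ)^{-(δ+1)} (log(e/(1-ρr)))^k dr and I₂(ρ) = ∫₀¹ (1-r)^δ (1-rρ)^{-(δ+1)} (log(e(1-ρr)/(1-ρ)))^k dr. Then there exist constants A₁, A₂ > 0 depending only on δ and k such that A₁ ≤ I₁(ρ) ≤ A₂ and A₁ ≤ I₂(ρ) ≤ A₂ for all 0 ≤ ρ < 1. -/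
open MeasureTheory Real

lemma aux_J (δ a : ℝ) (hδ : -1 < δ) (ha : a < 1) :
    ∫⁻ r in Set.Ioo a 1, ENNReal.ofReal ((1 - r) ^ δ)
      = ENNReal.ofReal ((1 - a) ^ (δ + 1) / (δ + 1)) := by
  have hi0 : IntervalIntegrable (fun x : ℝ => x ^ δ) volume (1 - a) (1 - 1) :=
    intervalIntegral.intervalIntegrable_rpow' hδ
  have hi : IntervalIntegrable (fun x : ℝ => (1 - x) ^ δ) volume a 1 := by
    simpa using hi0.comp_sub_left 1
  rw [intervalIntegrable_iff_integrableOn_Ioo_of_le ha.le] at hi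
  rw [← ofReal_integral_eq_lintegral_ofReal hi]
  · congr 1
    rw [← integral_Ioc_eq_integral_Ioo, ← intervalIntegral.integral_of_le ha.le,
      intervalIntegral.integral_comp_sub_left (fun x : ℝ => x ^ δ) 1,
      integral_rpow (Or.inl hδ)]
    simp [Real.zero_rpow (by linarith : δ + 1 ≠ 0)]
  · filter_upwards [ae_restrict_mem measurableSet_Ioo] with r hr
    exact Real.rpow_nonneg (by linarith [hr.2]) _

lemma aux_ftc (k C ε ρ : ℝ) (L : ℝ → ℝ) (hk : k < -1) (hC : 0 ≤ C) (hε : ε = 1 ∨ ε = -1)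
    (h1 : 1 / 2 ≤ ρ) (h2 : ρ < 1) (hL : ∀ r ∈ Set.Icc (0:ℝ) 1, 1 ≤ L r)
    (hd : ∀ r ∈ Set.Icc (0:ℝ) 1, HasDerivAt L (ε * ρ / (1 - ρ * r)) r) :
    ∫⁻ r in Set.Ioc (0:ℝ) 1, ENNReal.ofReal (C * ((1 - ρ * r)⁻¹ * L r ^ k))
      ≤ ENNReal.ofReal (C * (2 / (-(k + 1)))) := by
  have hu : ∀ r ∈ Set.Icc (0:ℝ) 1, 0 < 1 - ρ * r := by
    intro r hr
    nlinarith [hr.1, hr.2]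
  have hcL : ContinuousOn L (Set.Icc 0 1) := fun r hr => (hd r hr).continuousAt.continuousWithinAt
  have hc : ContinuousOn (fun r => C * ((1 - ρ * r)⁻¹ * L r ^ k)) (Set.Icc 0 1) := by
    refine continuousOn_const.mul (ContinuousOn.mul ?_ ?_)
    · exact ContinuousOn.inv₀ (by fun_prop) (fun r hr => (hu r hr).ne')
    · exact hcL.rpow_const (fun r hr => Or.inl (by linarith [hL r hr]))
  have hii : IntervalIntegrable (fun r => C * ((1 - ρ * r)⁻¹ * L r ^ k)) volume 0 1 :=
    ContinuousOn.intervalIntegrable (by rwa [Set.uIcc_of_le zero_le_one])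
  have hi := hii
  rw [intervalIntegrable_iff_integrableOn_Ioc_of_le zero_le_one] at hi
  have hρ : ρ ≠ 0 := by linarith
  have hk1 : k + 1 ≠ 0 := by linarith
  have hεε : ε * ε = 1 := by rcases hε with rfl | rfl <;> norm_num
  rw [← ofReal_integral_eq_lintegral_ofReal hi]
  · apply ENNReal.ofReal_le_ofReal
    rw [← intervalIntegral.integral_of_le zero_le_one]
    rw [intervalIntegral.integral_eq_sub_of_hasDerivAt
      (f := fun r => C * ε / (ρ * (k + 1)) * L r ^ (k + 1)) _ hii]
    · have hb : ∀ r ∈ Set.Icc (0:ℝ) 1, 0 ≤ L r ^ (k + 1) ∧ L r ^ (k + 1) ≤ 1 := by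
        intro r hr
        exact ⟨Real.rpow_nonneg (by linarith [hL r hr]) _,
          Real.rpow_le_one_of_one_le_of_nonpos (hL r hr) (by linarith)⟩
      obtain ⟨a1, a2⟩ := hb 0 (by simp)
      obtain ⟨b1, b2⟩ := hb 1 (by simp)
      have hx : ε * (L 0 ^ (k + 1) - L 1 ^ (k + 1)) ≤ 1 := by
        rcases hε with rfl | rfl <;> linarith
      have hk2 : 0 < -(k + 1) := by linarith
      calc C * ε / (ρ * (k + 1)) * L 1 ^ (k + 1) - C * ε / (ρ * (k + 1)) * L 0 ^ (k + 1)
          = C * ((1 / ρ) * (1 / (-(k + 1))) * (ε * (L 0 ^ (k + 1) - L 1 ^ (k + 1)))) := by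
            field_simp
            ring
        _ ≤ C * (2 * (1 / (-(k + 1))) * 1) := by
            apply mul_le_mul_of_nonneg_left _ hC
            have h3 : 1 / ρ ≤ 2 := by
              rw [div_le_iff₀ (by linarith)]; linarith
            have h4 : 0 < 1 / ρ := by positivity
            have h5 : 0 < 1 / (-(k + 1)) := by positivity
            calc _ ≤ (1 / ρ) * (1 / (-(k + 1))) * 1 :=
                  mul_le_mul_of_nonneg_left hx (by positivity)
              _ ≤ _ := by gcongr
        _ = _ := by ring
    · intro r hr
      rw [Set.uIcc_of_le zero_le_one] at hr
      have hLr : 0 < L r := by linarith [hL r hr]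
      have := ((hd r hr).rpow_const (p := k + 1) (Or.inl hLr.ne')).const_mul
        (C * ε / (ρ * (k + 1)))
      have hur := (hu r hr).ne'
      refine this.congr_deriv ?_
      rw [add_sub_cancel_right]
      field_simp
      linear_combination C * hεε
  · filter_upwards [ae_restrict_mem measurableSet_Ioc] with r hr
    have hr' : r ∈ Set.Icc (0:ℝ) 1 := ⟨hr.1.le, hr.2⟩
    have := hu r hr'
    have hLr : 0 < L r := by linarith [hL r hr']
    have := Real.rpow_nonneg hLr.le k
    simp only [Pi.zero_apply]
    positivity

lemma aux_ratio (δ s u : ℝ) (hs : 0 < s) (h1 : s ≤ u) (h2 : u ≤ 2 * s) (hδ : -1 < δ) :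
    s ^ δ * u ^ (-(δ + 1)) ≤ 2 * u⁻¹ := by
  have hu : 0 < u := by linarith
  have : s ^ δ ≤ 2 * u ^ δ := by
    rcases le_total 0 δ with h | h
    · have := Real.rpow_le_rpow hs.le h1 h
      have := Real.rpow_nonneg hu.le δ
      linarith
    · have h3 : (u / 2) ^ δ ≥ s ^ δ :=
        Real.rpow_le_rpow_of_nonpos (by linarith) (by linarith) h
      rw [Real.div_rpow hu.le (by norm_num)] at h3
      have h4 : (2:ℝ) ^ (-1:ℝ) ≤ 2 ^ δ :=
        Real.rpow_le_rpow_of_exponent_le (by norm_num) hδ.le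
      rw [Real.rpow_neg_one] at h4
      have h5 : u ^ δ / 2 ^ δ ≤ u ^ δ / 2⁻¹ := by gcongr
      have h6 : u ^ δ / (2:ℝ)⁻¹ = 2 * u ^ δ := by field_simp
      linarith
  calc s ^ δ * u ^ (-(δ + 1)) ≤ 2 * u ^ δ * u ^ (-(δ + 1)) := by gcongr
    _ = 2 * (u ^ δ * u ^ (-(δ + 1))) := by ring
    _ = 2 * u⁻¹ := by
      rw [← Real.rpow_add hu, show δ + -(δ + 1) = -1 by ring, Real.rpow_neg_one]

lemma aux_upper (δ k ε ρ : ℝ) (L : ℝ → ℝ) (hδ : -1 < δ) (hk : k < -1) (hε : ε = 1 ∨ ε = -1)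
    (h0 : 0 ≤ ρ) (h2 : ρ < 1) (hL : ∀ r ∈ Set.Icc (0:ℝ) 1, 1 ≤ L r)
    (hd : ∀ r ∈ Set.Icc (0:ℝ) 1, HasDerivAt L (ε * ρ / (1 - ρ * r)) r) :
    ∫⁻ r in Set.Ioo (0:ℝ) 1, ENNReal.ofReal ((1 - r) ^ δ * (1 - r * ρ) ^ (-(δ + 1)) * L r ^ k)
      ≤ ENNReal.ofReal (2 ^ (δ + 1) / (δ + 1) + (1 / (δ + 1) + 2 * (2 / (-(k + 1))))) := by
  have hδ1 : 0 < δ + 1 := by linarith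
  have hk2 : 0 < -(k + 1) := by linarith
  have hp : (0:ℝ) < 2 ^ (δ + 1) := by positivity
  -- crude pointwise bound
  have key : ∀ r ∈ Set.Ioo (0:ℝ) 1, ∀ m, 0 < m → m ≤ 1 - ρ * r →
      (1 - r) ^ δ * (1 - r * ρ) ^ (-(δ + 1)) * L r ^ k ≤ m ^ (-(δ + 1)) * (1 - r) ^ δ := by
    intro r hr m hm hmr
    have e1 : L r ^ k ≤ 1 :=
      Real.rpow_le_one_of_one_le_of_nonpos (hL r ⟨hr.1.le, hr.2.le⟩) (by linarith)
    have e2 : (1 - r * ρ) ^ (-(δ + 1)) ≤ m ^ (-(δ + 1)) :=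
      Real.rpow_le_rpow_of_nonpos hm (by linarith) (by linarith)
    have e3 : 0 ≤ (1 - r) ^ δ := Real.rpow_nonneg (by linarith [hr.2]) _
    have e4 : 0 ≤ (1 - r * ρ) ^ (-(δ + 1)) := Real.rpow_nonneg (by linarith) _
    calc _ ≤ (1 - r) ^ δ * (1 - r * ρ) ^ (-(δ + 1)) * 1 := by gcongr
      _ ≤ (1 - r) ^ δ * m ^ (-(δ + 1)) * 1 := by gcongr
      _ = _ := by ring
  have keyint : ∀ a, 0 ≤ a → a < 1 → ∀ m, 0 < m →
      (∀ r ∈ Set.Ioo (0:ℝ) 1, m ≤ 1 - ρ * r) →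
      ∫⁻ r in Set.Ioo a 1, ENNReal.ofReal ((1 - r) ^ δ * (1 - r * ρ) ^ (-(δ + 1)) * L r ^ k)
      ≤ ENNReal.ofReal (m ^ (-(δ + 1)) * ((1 - a) ^ (δ + 1) / (δ + 1))) := by
    intro a ha0 ha m hm hmr
    have hmp : 0 ≤ m ^ (-(δ + 1)) := Real.rpow_nonneg hm.le _
    rw [ENNReal.ofReal_mul hmp, ← aux_J δ a hδ ha, ← lintegral_const_mul' _ _ ENNReal.ofReal_ne_top]
    refine setLIntegral_mono' measurableSet_Ioo fun r hr => ?_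
    have hr' : r ∈ Set.Ioo (0:ℝ) 1 := ⟨by linarith [hr.1], hr.2⟩
    rw [← ENNReal.ofReal_mul hmp]
    exact ENNReal.ofReal_le_ofReal (key r hr' m hm (hmr r hr'))
  rcases le_total ρ (1 / 2) with h | h
  · refine (keyint 0 le_rfl zero_lt_one (1 / 2) (by norm_num) ?_).trans
      (ENNReal.ofReal_le_ofReal ?_)
    · intro r hr
      nlinarith [hr.1, hr.2]
    · have e : ((1:ℝ) / 2) ^ (-(δ + 1)) = 2 ^ (δ + 1) := by
        rw [one_div, Real.inv_rpow (by norm_num), Real.rpow_neg (by norm_num), inv_inv]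
      rw [e]
      simp only [sub_zero, Real.one_rpow]
      have : 0 ≤ 1 / (δ + 1) + 2 * (2 / (-(k + 1))) := by positivity
      rw [mul_one_div]
      linarith
  · have hsub : Set.Ioo (0:ℝ) 1 ⊆ Set.Ioo ρ 1 ∪ Set.Ioc 0 ρ := by
      intro r hr
      rcases le_or_gt r ρ with h' | h'
      · exact Or.inr ⟨hr.1, h'⟩
      · exact Or.inl ⟨h', hr.2⟩
    refine (lintegral_mono_set hsub).trans ((lintegral_union_le _ _ _).trans ?_)
    have hA := keyint ρ h0 h2 (1 - ρ) (by linarith) (fun r hr => by nlinarith [hr.1, hr.2])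
    have hB : ∫⁻ r in Set.Ioc 0 ρ,
        ENNReal.ofReal ((1 - r) ^ δ * (1 - r * ρ) ^ (-(δ + 1)) * L r ^ k)
        ≤ ENNReal.ofReal (2 * (2 / (-(k + 1)))) := by
      refine le_trans ?_ (aux_ftc k 2 ε ρ L hk (by norm_num) hε h h2 hL hd)
      refine le_trans ?_ (lintegral_mono_set (Set.Ioc_subset_Ioc_right h2.le))
      refine setLIntegral_mono' measurableSet_Ioc fun r hr => ENNReal.ofReal_le_ofReal ?_
      have hr1 : r < 1 := by linarith [hr.2]
      have := aux_ratio δ (1 - r) (1 - r * ρ) (by linarith) (by nlinarith [hr.1])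
        (by nlinarith [hr.1, hr.2]) hδ
      have e1 : 0 ≤ L r ^ k := Real.rpow_nonneg (by linarith [hL r ⟨hr.1.le, hr1.le⟩]) _
      calc _ ≤ 2 * (1 - r * ρ)⁻¹ * L r ^ k := by gcongr
        _ = _ := by rw [mul_comm r ρ]; ring
    have eA : (1 - ρ) ^ (-(δ + 1)) * ((1 - ρ) ^ (δ + 1) / (δ + 1)) = 1 / (δ + 1) := by
      rw [← mul_div_assoc, ← Real.rpow_add (by linarith)]
      simp
    rw [eA] at hA
    refine (add_le_add hA hB).trans ?_
    rw [← ENNReal.ofReal_add (by positivity) (by positivity)]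
    apply ENNReal.ofReal_le_ofReal
    have : 0 ≤ (2:ℝ) ^ (δ + 1) / (δ + 1) := by positivity
    linarith

lemma aux_low1 (δ k ρ : ℝ) (hδ : -1 < δ) (hk : k < -1) (h0 : 0 ≤ ρ) (h2 : ρ < 1) (L : ℝ → ℝ)
    (hL : ∀ r ∈ Set.Ioo (0:ℝ) 1, 1 ≤ L r) (hL2 : ∀ r ∈ Set.Ioo (0:ℝ) (1/2), L r ≤ 2) :
    ENNReal.ofReal (2 ^ (-|δ|) * 2 ^ k * (1 / 2)) ≤
    ∫⁻ r in Set.Ioo (0:ℝ) 1,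
      ENNReal.ofReal ((1 - r) ^ δ * (1 - r * ρ) ^ (-(δ + 1)) * L r ^ k) := by
  refine le_trans ?_ (lintegral_mono_set
    (Set.Ioo_subset_Ioo_right (by norm_num : (1/2:ℝ) ≤ 1)))
  have : ENNReal.ofReal (2 ^ (-|δ|) * 2 ^ k * (1 / 2)) =
      ∫⁻ r in Set.Ioo (0:ℝ) (1/2), ENNReal.ofReal (2 ^ (-|δ|) * 2 ^ k) := by
    rw [setLIntegral_const, Real.volume_Ioo, ← ENNReal.ofReal_mul (by positivity), sub_zero]
  rw [this]
  refine setLIntegral_mono' measurableSet_Ioo fun r hr => ENNReal.ofReal_le_ofReal ?_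
  have hr1 : r < 1 := by linarith [hr.2]
  have e1 : (2:ℝ) ^ k ≤ L r ^ k :=
    Real.rpow_le_rpow_of_nonpos (by linarith [hL r ⟨hr.1, hr1⟩]) (hL2 r hr) (by linarith)
  have e2 : 1 ≤ (1 - r * ρ) ^ (-(δ + 1)) :=
    Real.one_le_rpow_of_pos_of_le_one_of_nonpos (by nlinarith [hr.1]) (by nlinarith [hr.1])
      (by linarith)
  have e3 : (2:ℝ) ^ (-|δ|) ≤ (1 - r) ^ δ := by
    rw [Real.rpow_neg (by norm_num), ← Real.inv_rpow (by norm_num)]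
    calc ((2:ℝ)⁻¹) ^ |δ| ≤ (1 - r) ^ |δ| :=
          Real.rpow_le_rpow (by norm_num) (by linarith [hr.2]) (abs_nonneg _)
      _ ≤ (1 - r) ^ δ := Real.rpow_le_rpow_of_exponent_ge (by linarith) (by linarith [hr.1])
          (le_abs_self _)
  calc (2:ℝ) ^ (-|δ|) * 2 ^ k = 2 ^ (-|δ|) * 1 * 2 ^ k := by ring
    _ ≤ _ := by gcongr

lemma aux_low2 (δ k ρ : ℝ) (hδ : -1 < δ) (hk : k < -1) (h0 : 0 ≤ ρ) (h2 : ρ < 1) (L : ℝ → ℝ)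
    (hL : ∀ r ∈ Set.Ioo (0:ℝ) 1, 1 ≤ L r) (hL2 : ∀ r ∈ Set.Ioo (ρ:ℝ) 1, L r ≤ 2) :
    ENNReal.ofReal (2 ^ (-(δ + 1)) * 2 ^ k * (1 / (δ + 1))) ≤
    ∫⁻ r in Set.Ioo (0:ℝ) 1,
      ENNReal.ofReal ((1 - r) ^ δ * (1 - r * ρ) ^ (-(δ + 1)) * L r ^ k) := by
  refine le_trans ?_ (lintegral_mono_set (Set.Ioo_subset_Ioo_left h0))
  have hc : (0:ℝ) ≤ (2 * (1 - ρ)) ^ (-(δ + 1)) * 2 ^ k :=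
    mul_nonneg (Real.rpow_nonneg (by linarith) _) (by positivity)
  have e : (2:ℝ) ^ (-(δ + 1)) * 2 ^ k * (1 / (δ + 1)) =
      ((2 * (1 - ρ)) ^ (-(δ + 1)) * 2 ^ k) * ((1 - ρ) ^ (δ + 1) / (δ + 1)) := by
    have h3 : (1 - ρ) ^ (-(δ + 1)) * (1 - ρ) ^ (δ + 1) = 1 := by
      rw [← Real.rpow_add (by linarith)]; simp
    rw [Real.mul_rpow (by norm_num) (by linarith)]
    calc _ = (2:ℝ) ^ (-(δ + 1)) * 2 ^ k * (((1 - ρ) ^ (-(δ + 1)) * (1 - ρ) ^ (δ + 1)) / (δ + 1)) := by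
          rw [h3]
      _ = _ := by ring
  rw [e, ENNReal.ofReal_mul hc, ← aux_J δ ρ hδ h2, ← lintegral_const_mul' _ _ ENNReal.ofReal_ne_top]
  refine setLIntegral_mono' measurableSet_Ioo fun r hr => ?_
  rw [← ENNReal.ofReal_mul hc]
  apply ENNReal.ofReal_le_ofReal
  have hr0 : 0 < r := by linarith [hr.1]
  have e1 : (2:ℝ) ^ k ≤ L r ^ k :=
    Real.rpow_le_rpow_of_nonpos (by linarith [hL r ⟨hr0, hr.2⟩]) (hL2 r hr) (by linarith)
  have e2 : (2 * (1 - ρ)) ^ (-(δ + 1)) ≤ (1 - r * ρ) ^ (-(δ + 1)) :=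
    Real.rpow_le_rpow_of_nonpos (by nlinarith [hr.2]) (by nlinarith [hr.1, hr.2]) (by linarith)
  have e3 : 0 ≤ (1 - r) ^ δ := Real.rpow_nonneg (by linarith [hr.2]) _
  have e4 : 0 ≤ (1 - r * ρ) ^ (-(δ + 1)) := Real.rpow_nonneg (by nlinarith [hr.2]) _
  calc (2 * (1 - ρ)) ^ (-(δ + 1)) * 2 ^ k * (1 - r) ^ δ
      = (1 - r) ^ δ * (2 * (1 - ρ)) ^ (-(δ + 1)) * 2 ^ k := by ring
    _ ≤ _ := by gcongr

/-- **Lemma 2.1 (1).** For `δ > -1`, `c = 0`, `k < -1`, the integrals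
`I₁(ρ) = ∫₀¹ (1-r)^δ (1-rρ)^{-(δ+1)} (log(e/(1-ρr)))^k dr` and
`I₂(ρ) = ∫₀¹ (1-r)^δ (1-rρ)^{-(δ+1)} (log(e(1-ρr)/(1-ρ)))^k dr`
are bounded above and below by positive constants independent of `ρ ∈ [0,1)`. -/
theorem lemma21_case1 (δ k : ℝ) (hδ : -1 < δ) (hk : k < -1) :
    ∃ A₁ A₂ : ℝ, 0 < A₁ ∧ 0 < A₂ ∧ ∀ ρ : ℝ, 0 ≤ ρ → ρ < 1 →
      (ENNReal.ofReal A₁ ≤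
          ∫⁻ r in Set.Ioo (0:ℝ) 1,
            ENNReal.ofReal ((1 - r) ^ δ * (1 - r * ρ) ^ (-(δ + 1)) *
              Real.log (Real.exp 1 / (1 - ρ * r)) ^ k)) ∧
      ((∫⁻ r in Set.Ioo (0:ℝ) 1,
            ENNReal.ofReal ((1 - r) ^ δ * (1 - r * ρ) ^ (-(δ + 1)) *
              Real.log (Real.exp 1 / (1 - ρ * r)) ^ k)) ≤ ENNReal.ofReal A₂) ∧
      (ENNReal.ofReal A₁ ≤
          ∫⁻ r in Set.Ioo (0:ℝ) 1,
            ENNReal.ofReal ((1 - r) ^ δ * (1 - r * ρ) ^ (-(δ + 1)) *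
              Real.log (Real.exp 1 * (1 - ρ * r) / (1 - ρ)) ^ k)) ∧
      ((∫⁻ r in Set.Ioo (0:ℝ) 1,
            ENNReal.ofReal ((1 - r) ^ δ * (1 - r * ρ) ^ (-(δ + 1)) *
              Real.log (Real.exp 1 * (1 - ρ * r) / (1 - ρ)) ^ k)) ≤ ENNReal.ofReal A₂) := by
  have hδ1 : 0 < δ + 1 := by linarith
  have hk2 : 0 < -(k + 1) := by linarith
  refine ⟨min (2 ^ (-|δ|) * 2 ^ k * (1 / 2)) (2 ^ (-(δ + 1)) * 2 ^ k * (1 / (δ + 1))),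
    2 ^ (δ + 1) / (δ + 1) + (1 / (δ + 1) + 2 * (2 / (-(k + 1)))),
    lt_min (by positivity) (by positivity), by positivity, ?_⟩
  intro ρ h0 h2
  have hu : ∀ r ∈ Set.Icc (0:ℝ) 1, 0 < 1 - ρ * r := fun r hr => by nlinarith [hr.1, hr.2]
  have ht : 0 < 1 - ρ := by linarith
  have hlog1 : ∀ r ∈ Set.Icc (0:ℝ) 1,
      Real.log (Real.exp 1 / (1 - ρ * r)) = 1 - Real.log (1 - ρ * r) := fun r hr => by
    rw [Real.log_div (Real.exp_pos 1).ne' (hu r hr).ne', Real.log_exp]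
  have hlog2 : ∀ r ∈ Set.Icc (0:ℝ) 1,
      Real.log (Real.exp 1 * (1 - ρ * r) / (1 - ρ))
        = 1 + Real.log ((1 - ρ * r) / (1 - ρ)) := fun r hr => by
    rw [mul_div_assoc, Real.log_mul (Real.exp_pos 1).ne' (div_pos (hu r hr) ht).ne', Real.log_exp]
  have hL1 : ∀ r ∈ Set.Icc (0:ℝ) 1, 1 ≤ Real.log (Real.exp 1 / (1 - ρ * r)) := fun r hr => by
    rw [hlog1 r hr]
    have := Real.log_nonpos (hu r hr).le (by nlinarith [hr.1])
    linarith
  have hL2 : ∀ r ∈ Set.Icc (0:ℝ) 1,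
      1 ≤ Real.log (Real.exp 1 * (1 - ρ * r) / (1 - ρ)) := fun r hr => by
    rw [hlog2 r hr]
    have := Real.log_nonneg (x := (1 - ρ * r) / (1 - ρ))
      (by rw [le_div_iff₀ ht]; nlinarith [hr.1, hr.2])
    linarith
  have hl2 : Real.log 2 ≤ 1 := by linarith [Real.log_two_lt_d9]
  have hdu : ∀ r : ℝ, HasDerivAt (fun r => 1 - ρ * r) (-ρ) r := fun r => by
    simpa using ((hasDerivAt_id r).const_mul ρ).const_sub 1
  refine ⟨?_, ?_, ?_, ?_⟩
  · refine (ENNReal.ofReal_le_ofReal (min_le_left _ _)).trans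
      (aux_low1 δ k ρ hδ hk h0 h2 (fun r => Real.log (Real.exp 1 / (1 - ρ * r)))
        (fun r hr => hL1 r ⟨hr.1.le, hr.2.le⟩) ?_)
    intro r hr
    have hr' : r ∈ Set.Icc (0:ℝ) 1 := ⟨hr.1.le, by linarith [hr.2]⟩
    simp only [hlog1 r hr']
    have := Real.log_le_log (x := 1 / 2) (y := 1 - ρ * r) (by norm_num)
      (by nlinarith [hr.1, hr.2])
    rw [one_div, Real.log_inv] at this
    linarith
  · refine aux_upper δ k 1 ρ (fun r => Real.log (Real.exp 1 / (1 - ρ * r))) hδ hk (Or.inl rfl)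
      h0 h2 hL1 ?_
    intro r hr
    have hur := (hu r hr).ne'
    have h3 := ((hasDerivAt_const r (Real.exp 1)).div (hdu r) hur).log
      (div_pos (Real.exp_pos 1) (hu r hr)).ne'
    have := (Real.exp_pos 1).ne'
    refine HasDerivAt.congr_deriv h3 ?_
    change (0 * (1 - ρ * r) - rexp 1 * -ρ) / (1 - ρ * r) ^ 2 / (rexp 1 / (1 - ρ * r)) = _
    field_simp
    ring
  · refine (ENNReal.ofReal_le_ofReal (min_le_right _ _)).trans
      (aux_low2 δ k ρ hδ hk h0 h2 (fun r => Real.log (Real.exp 1 * (1 - ρ * r) / (1 - ρ)))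
        (fun r hr => hL2 r ⟨hr.1.le, hr.2.le⟩) ?_)
    intro r hr
    have hr' : r ∈ Set.Icc (0:ℝ) 1 := ⟨by linarith [hr.1], hr.2.le⟩
    simp only [hlog2 r hr']
    have := Real.log_le_log (x := (1 - ρ * r) / (1 - ρ)) (y := 2) (div_pos (hu r hr') ht)
      (by rw [div_le_iff₀ ht]; nlinarith [hr.1, hr.2])
    linarith
  · refine aux_upper δ k (-1) ρ (fun r => Real.log (Real.exp 1 * (1 - ρ * r) / (1 - ρ))) hδ hk
      (Or.inr rfl) h0 h2 hL2 ?_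
    intro r hr
    have hur := (hu r hr).ne'
    have h3 := (((hdu r).const_mul (Real.exp 1)).div_const (1 - ρ)).log
      (div_pos (mul_pos (Real.exp_pos 1) (hu r hr)) ht).ne'
    convert h3 using 1
    have := (Real.exp_pos 1).ne'
    field_simp
end

section
/- Let δ > -1, c > 0 and let k be a real number. Define, for 0 ≤ ρ < 1, I₁(ρ) = ∫₀¹ (1-r)^δ (1-rρ)^{-(δ+1+c)} (log(e/(1-ρr)))^k dr. Then I₁(ρ) ≍ (1-ρ)^{-c} (log(e/(1-ρ)))^k, with the implicit constants depending only on δ, c, k and not on ρ ∈ [0,1). -/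
open MeasureTheory Real

lemma aux_A (δ x : ℝ) (hδ : -1 < δ) (hx : 0 < x) :
    ∫⁻ s in Set.Ioo (0:ℝ) x, ENNReal.ofReal (s ^ δ) = ENNReal.ofReal (x ^ (δ+1) / (δ+1)) := by
  have hi : IntervalIntegrable (fun s : ℝ => s ^ δ) volume 0 x :=
    intervalIntegral.intervalIntegrable_rpow' hδ
  rw [intervalIntegrable_iff_integrableOn_Ioo_of_le hx.le] at hi
  rw [← ofReal_integral_eq_lintegral_ofReal hi]
  · rw [← integral_Ioc_eq_integral_Ioo, ← intervalIntegral.integral_of_le hx.le,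
      integral_rpow (Or.inl hδ), Real.zero_rpow (by linarith), sub_zero]
  · refine (ae_restrict_iff' measurableSet_Ioo).2 (Filter.Eventually.of_forall fun s hs => ?_)
    exact Real.rpow_nonneg hs.1.le _

lemma aux_B (c x : ℝ) (hc : 0 < c) (hx : 0 < x) :
    ∫⁻ s in Set.Ioi x, ENNReal.ofReal (s ^ (-1-c)) = ENNReal.ofReal (x ^ (-c) / c) := by
  have hi : IntegrableOn (fun s : ℝ => s ^ (-1-c)) (Set.Ioi x) :=
    integrableOn_Ioi_rpow_of_lt (by linarith) hx
  rw [← ofReal_integral_eq_lintegral_ofReal hi]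
  · rw [integral_Ioi_rpow_of_lt (by linarith) hx]
    congr 1
    rw [show -1 - c + 1 = -c by ring, neg_div_neg_eq]
  · refine (ae_restrict_iff' measurableSet_Ioi).2 (Filter.Eventually.of_forall fun s hs => ?_)
    exact Real.rpow_nonneg (hx.trans hs).le _

lemma aux_flip (f : ℝ → ENNReal) :
    ∫⁻ r in Set.Ioo (0:ℝ) 1, f r = ∫⁻ s in Set.Ioo (0:ℝ) 1, f (1 - s) := by
  rw [← lintegral_indicator measurableSet_Ioo, ← lintegral_indicator measurableSet_Ioo,
    ← lintegral_sub_left_eq_self _ (1:ℝ)]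
  congr 1
  ext s
  by_cases h : s ∈ Set.Ioo (0:ℝ) 1
  · rw [Set.indicator_of_mem h, Set.indicator_of_mem]
    exact ⟨by linarith [h.2], by linarith [h.1]⟩
  · rw [Set.indicator_of_notMem h, Set.indicator_of_notMem]
    intro h'
    exact h ⟨by linarith [h'.2], by linarith [h'.1]⟩

lemma aux_L (t : ℝ) (ht : 0 < t) : Real.log (Real.exp 1 / t) = 1 - Real.log t := by
  rw [Real.log_div (Real.exp_pos 1).ne' ht.ne', Real.log_exp]

/-- comparison of the logs -/
lemma aux_ratio_s1 (x y : ℝ) (hx : 0 < x) (hxy : x ≤ y) (hy : y ≤ 1) :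
    1 ≤ 1 - Real.log y ∧ 1 - Real.log y ≤ 1 - Real.log x ∧
      1 - Real.log x ≤ (1 + Real.log (y / x)) * (1 - Real.log y) := by
  have hy0 : 0 < y := hx.trans_le hxy
  have h1 : Real.log y ≤ 0 := Real.log_nonpos hy0.le hy
  have h2 : Real.log x ≤ Real.log y := Real.log_le_log hx hxy
  refine ⟨by linarith, by linarith, ?_⟩
  rw [Real.log_div hy0.ne' hx.ne']
  nlinarith

lemma aux_upper_s1 (k ε : ℝ) (hε : 0 < ε) : ∃ C : ℝ, 0 < C ∧ ∀ x y : ℝ, 0 < x → x ≤ y → y ≤ 1 →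
    (1 - Real.log y) ^ k ≤ C * (y / x) ^ ε * (1 - Real.log x) ^ k := by
  rcases le_or_gt 0 k with hk | hk
  · refine ⟨1, one_pos, fun x y hx hxy hy => ?_⟩
    obtain ⟨h1, h2, -⟩ := aux_ratio_s1 x y hx hxy hy
    have h3 : (1 - Real.log y) ^ k ≤ (1 - Real.log x) ^ k :=
      Real.rpow_le_rpow (by linarith) h2 hk
    have h4 : 1 ≤ (y / x) ^ ε := Real.one_le_rpow ((one_le_div hx).2 hxy) hε.le
    have h5 : 0 ≤ (1 - Real.log x) ^ k := Real.rpow_nonneg (by linarith) _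
    nlinarith
  · set η := ε / (-k) with hη
    have hη0 : 0 < η := div_pos hε (by linarith)
    refine ⟨(1 + 1/η) ^ (-k), by positivity, fun x y hx hxy hy => ?_⟩
    obtain ⟨h1, h2, h3⟩ := aux_ratio_s1 x y hx hxy hy
    have hu : 1 ≤ y / x := (one_le_div hx).2 hxy
    have h4 : Real.log (y/x) ≤ (y/x) ^ η / η := Real.log_le_rpow_div (by linarith) hη0
    have h5 : 1 ≤ (y / x) ^ η := Real.one_le_rpow hu hη0.le
    have h6 : 1 - Real.log x ≤ ((1 + 1/η) * (y/x) ^ η) * (1 - Real.log y) := by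
      refine h3.trans (mul_le_mul_of_nonneg_right ?_ (by linarith))
      have : (1 + 1/η) * (y/x) ^ η = (y/x)^η + (y/x) ^ η / η := by ring
      linarith
    have h7 := Real.rpow_le_rpow (by linarith) h6 (by linarith : 0 ≤ -k)
    rw [Real.mul_rpow (by positivity) (by linarith), Real.mul_rpow (by positivity) (by positivity),
      ← Real.rpow_mul (by linarith), show η * -k = ε by rw [hη]; field_simp [hk.ne]] at h7
    rw [Real.rpow_neg (by linarith) k, Real.rpow_neg (by linarith : 0 ≤ 1 - Real.log y) k] at h7
    have hX : 0 < (1 - Real.log x) ^ k := Real.rpow_pos_of_pos (by linarith) _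
    have hY : 0 < (1 - Real.log y) ^ k := Real.rpow_pos_of_pos (by linarith) _
    rw [← div_eq_mul_inv, le_div_iff₀ hY, inv_mul_le_iff₀ hX] at h7
    linarith

lemma aux_lower (k x y : ℝ) (hx : 0 < x) (hxy : x ≤ y) (hy : y ≤ 1) (hy2 : y ≤ 2 * x) :
    2 ^ (-|k|) * (1 - Real.log x) ^ k ≤ (1 - Real.log y) ^ k := by
  obtain ⟨h1, h2, h3⟩ := aux_ratio_s1 x y hx hxy hy
  rcases le_or_gt 0 k with hk | hk
  · have h4 : Real.log (y/x) ≤ y / x - 1 := Real.log_le_sub_one_of_pos (div_pos (hx.trans_le hxy) hx)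
    have h5 : y / x ≤ 2 := (div_le_iff₀ hx).2 hy2
    have h6 : 1 - Real.log x ≤ 2 * (1 - Real.log y) := by nlinarith
    have h7 := Real.rpow_le_rpow (by linarith) h6 hk
    rw [Real.mul_rpow (by norm_num) (by linarith)] at h7
    rw [abs_of_nonneg hk, Real.rpow_neg (by norm_num), inv_mul_le_iff₀ (by positivity)]
    exact h7
  · have h4 : (1 - Real.log x) ^ k ≤ (1 - Real.log y) ^ k :=
      Real.rpow_le_rpow_of_nonpos (by linarith) h2 hk.le
    have h5 : (2:ℝ) ^ (-|k|) ≤ 1 :=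
      Real.rpow_le_one_of_one_le_of_nonpos (by norm_num) (by simp)
    have h6 : 0 ≤ (1 - Real.log x) ^ k := Real.rpow_nonneg (by linarith) _
    nlinarith

lemma aux_int (δ c x : ℝ) (hδ : -1 < δ) (hc : 0 < c) (hx : 0 < x) (hx1 : x ≤ 1) :
    ∫⁻ s in Set.Ioo (0:ℝ) 1, ENNReal.ofReal (s ^ δ * (s + x - s * x) ^ (-(δ+1+c))) ≤
      ENNReal.ofReal ((1/(δ+1) + 1/c) * x ^ (-c)) := by
  have hsub : Set.Ioo (0:ℝ) 1 ⊆ Set.Ioo 0 x ∪ Set.Ico x 1 := by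
    intro s hs
    rcases lt_or_ge s x with h | h
    · exact Or.inl ⟨hs.1, h⟩
    · exact Or.inr ⟨h, hs.2⟩
  refine (lintegral_mono_set hsub).trans ((lintegral_union_le _ _ _).trans ?_)
  have hδ1 : 0 < δ + 1 := by linarith
  rw [add_mul, ENNReal.ofReal_add (by positivity) (by positivity)]
  refine add_le_add ?_ ?_
  · calc _ ≤ ∫⁻ s in Set.Ioo (0:ℝ) x, ENNReal.ofReal (x ^ (-(δ+1+c))) * ENNReal.ofReal (s ^ δ) := by
          refine setLIntegral_mono' measurableSet_Ioo fun s hs => ?_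
          rw [← ENNReal.ofReal_mul (by positivity), mul_comm]
          refine ENNReal.ofReal_le_ofReal (mul_le_mul_of_nonneg_right ?_ (Real.rpow_nonneg hs.1.le _))
          exact Real.rpow_le_rpow_of_nonpos hx (by nlinarith [hs.1]) (by linarith)
      _ = ENNReal.ofReal (1 / (δ+1) * x ^ (-c)) := by
          rw [lintegral_const_mul' _ _ ENNReal.ofReal_ne_top, aux_A δ x hδ hx,
            ← ENNReal.ofReal_mul (by positivity), mul_div_assoc', ← Real.rpow_add hx]
          congr 1
          rw [show -(δ+1+c) + (δ+1) = -c by ring]; ring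
      _ ≤ _ := le_rfl
  · rw [show 1 / c * x ^ (-c) = x ^ (-c) / c by ring, ← aux_B c x hc hx]
    rw [← setLIntegral_congr (Ioi_ae_eq_Ici (a := x) (μ := volume)).symm]
    refine le_trans ?_ (lintegral_mono_set ((Set.Ico_subset_Ici_self : Set.Ico x 1 ⊆ Set.Ici x)))
    refine setLIntegral_mono' measurableSet_Ico fun s hs => ENNReal.ofReal_le_ofReal ?_
    have hs0 : 0 < s := hx.trans_le hs.1
    rw [show -1 - c = δ + (-(δ+1+c)) by ring, Real.rpow_add hs0]
    refine mul_le_mul_of_nonneg_left ?_ (by positivity)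
    exact Real.rpow_le_rpow_of_nonpos hs0 (by nlinarith [hs.2]) (by linarith)

/-- **Lemma 2.1 (2).** For `δ > -1`, `c > 0` and `k ∈ ℝ`,
`I₁(ρ) = ∫₀¹ (1-r)^δ (1-rρ)^{-(δ+1+c)} (log(e/(1-ρr)))^k dr ≍ (1-ρ)^{-c} (log(e/(1-ρ)))^k`
uniformly for `ρ ∈ [0,1)`. -/
theorem lemma21_case2 (δ c k : ℝ) (hδ : -1 < δ) (hc : 0 < c) :
    ∃ A₁ A₂ : ℝ, 0 < A₁ ∧ 0 < A₂ ∧ ∀ ρ : ℝ, 0 ≤ ρ → ρ < 1 →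
      (ENNReal.ofReal (A₁ * ((1 - ρ) ^ (-c) * Real.log (Real.exp 1 / (1 - ρ)) ^ k)) ≤
          ∫⁻ r in Set.Ioo (0:ℝ) 1,
            ENNReal.ofReal ((1 - r) ^ δ * (1 - r * ρ) ^ (-(δ + 1 + c)) *
              Real.log (Real.exp 1 / (1 - ρ * r)) ^ k)) ∧
      ((∫⁻ r in Set.Ioo (0:ℝ) 1,
            ENNReal.ofReal ((1 - r) ^ δ * (1 - r * ρ) ^ (-(δ + 1 + c)) *
              Real.log (Real.exp 1 / (1 - ρ * r)) ^ k)) ≤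
        ENNReal.ofReal (A₂ * ((1 - ρ) ^ (-c) * Real.log (Real.exp 1 / (1 - ρ)) ^ k))) := by
  have hδ1 : 0 < δ + 1 := by linarith
  obtain ⟨C, hC, hup⟩ := aux_upper_s1 k (c/2) (by linarith)
  refine ⟨2 ^ (-|k|) * 2 ^ (-(δ+1+c)) / (δ+1), C * (1/(δ+1) + 1/(c/2)), by positivity,
    by positivity, fun ρ h0 h1 => ?_⟩
  obtain ⟨x, rfl⟩ : ∃ x, ρ = 1 - x := ⟨1 - ρ, by ring⟩
  have hx : 0 < x := by linarith
  have hx1 : x ≤ 1 := by linarith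
  rw [aux_flip, show 1 - (1 - x) = x by ring, aux_L x hx]
  have hL : 0 < (1 - Real.log x) ^ k :=
    Real.rpow_pos_of_pos (by linarith [Real.log_nonpos hx.le hx1]) _
  have hcongr : ∫⁻ s in Set.Ioo (0:ℝ) 1,
            ENNReal.ofReal ((1 - (1 - s)) ^ δ * (1 - (1 - s) * (1 - x)) ^ (-(δ + 1 + c)) *
              Real.log (Real.exp 1 / (1 - (1 - x) * (1 - s))) ^ k) =
      ∫⁻ s in Set.Ioo (0:ℝ) 1,
            ENNReal.ofReal (s ^ δ * (s + x - s * x) ^ (-(δ + 1 + c)) *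
              (1 - Real.log (s + x - s * x)) ^ k) := by
    refine setLIntegral_congr_fun measurableSet_Ioo fun s hs => ?_
    have hy : 0 < s + x - s * x := by nlinarith [hs.1, hs.2]
    rw [← aux_L _ hy, show 1 - (1 - s) = s by ring,
      show 1 - (1 - s) * (1 - x) = s + x - s * x by ring,
      show 1 - (1 - x) * (1 - s) = s + x - s * x by ring]
  rw [hcongr]
  constructor
  · refine le_trans ?_ (lintegral_mono_set (Set.Ioo_subset_Ioo_right hx1))
    calc _ = ∫⁻ s in Set.Ioo (0:ℝ) x,
          ENNReal.ofReal ((2 * x) ^ (-(δ+1+c)) * (2 ^ (-|k|) * (1 - Real.log x) ^ k)) *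
            ENNReal.ofReal (s ^ δ) := by
          rw [lintegral_const_mul' _ _ ENNReal.ofReal_ne_top, aux_A δ x hδ hx,
            ← ENNReal.ofReal_mul (by positivity)]
          congr 1
          rw [Real.mul_rpow (by norm_num) hx.le, show -c = -(δ+1+c) + (δ+1) by ring,
            Real.rpow_add hx]
          ring
      _ ≤ _ := by
          refine setLIntegral_mono' measurableSet_Ioo fun s hs => ?_
          rw [← ENNReal.ofReal_mul (by positivity)]
          apply ENNReal.ofReal_le_ofReal
          have hs0 := hs.1
          have hsx := hs.2
          have hy1 : x ≤ s + x - s * x := by nlinarith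
          have hy2 : s + x - s * x ≤ 1 := by nlinarith
          have hy3 : s + x - s * x ≤ 2 * x := by nlinarith
          have e1 := aux_lower k x _ hx hy1 hy2 hy3
          have e2 : (2 * x) ^ (-(δ+1+c)) ≤ (s + x - s * x) ^ (-(δ+1+c)) :=
            Real.rpow_le_rpow_of_nonpos (by linarith) hy3 (by linarith)
          have e3 := mul_le_mul e2 e1 (by positivity) (Real.rpow_nonneg (by linarith) _)
          have e4 := mul_le_mul_of_nonneg_left e3 (Real.rpow_nonneg hs0.le δ)
          linarith
  · calc _ ≤ ∫⁻ s in Set.Ioo (0:ℝ) 1,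
          ENNReal.ofReal (C * x ^ (-(c/2)) * (1 - Real.log x) ^ k) *
            ENNReal.ofReal (s ^ δ * (s + x - s * x) ^ (-(δ+1+c/2))) := by
          refine setLIntegral_mono' measurableSet_Ioo fun s hs => ?_
          rw [← ENNReal.ofReal_mul (by positivity)]
          apply ENNReal.ofReal_le_ofReal
          have hs0 := hs.1
          have hs1 := hs.2
          have hy1 : x ≤ s + x - s * x := by nlinarith
          have hy2 : s + x - s * x ≤ 1 := by nlinarith
          have e1 := hup x _ hx hy1 hy2
          have hy0 : 0 < s + x - s * x := by linarith
          generalize s + x - s * x = y at *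
          have e4 := mul_le_mul_of_nonneg_left e1
            (by positivity : 0 ≤ s ^ δ * y ^ (-(δ+1+c)))
          refine e4.trans (le_of_eq ?_)
          rw [Real.div_rpow hy0.le hx.le, Real.rpow_neg hx.le,
            show -(δ+1+c/2) = -(δ+1+c) + c/2 by ring, Real.rpow_add hy0]
          ring
      _ ≤ ENNReal.ofReal (C * x ^ (-(c/2)) * (1 - Real.log x) ^ k) *
            ENNReal.ofReal ((1/(δ+1) + 1/(c/2)) * x ^ (-(c/2))) := by
          rw [lintegral_const_mul' _ _ ENNReal.ofReal_ne_top]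
          exact mul_le_mul_right (aux_int δ (c/2) x hδ (by linarith) hx hx1) _
      _ = _ := by
          rw [← ENNReal.ofReal_mul (by positivity)]
          congr 1
          rw [show -c = -(c/2) + -(c/2) by ring, Real.rpow_add hx]
          ring
end

section
/- Let δ > -1, c = 0 and k = -1. Define, for 0 ≤ ρ < 1, I₁(ρ) = ∫₀¹ (1-r)^δ (1-rρ)^{-(δ+1)} (log(e/(1-ρr)))^{-1} dr and I₂(ρ) = ∫₀¹ (1-r)^δ (1-rρ)^{-(δ+1)} (log(e(1-ρr)/(1-ρ)))^{-1} dr. Then I₁(ρ) ≍ I₂(ρ) ≍ log log(e²/(1-ρ)), with implicit constants depending only on δ and not on ρ ∈ [0,1). -/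
open MeasureTheory Real

lemma ftc_aux (a b : ℝ) (hab : a ≤ b) (F f : ℝ → ℝ) (hc : ContinuousOn F (Set.Icc a b))
    (hd : ∀ x ∈ Set.Ioo a b, HasDerivAt F (f x) x) (hn : ∀ x ∈ Set.Ioo a b, 0 ≤ f x) :
    ∫⁻ x in Set.Ioo a b, ENNReal.ofReal (f x) = ENNReal.ofReal (F b - F a) := by
  have hi : IntegrableOn f (Set.Ioc a b) :=
    intervalIntegral.integrableOn_deriv_of_nonneg hc hd hn
  have h1 : ∫ y in a..b, f y = F b - F a :=
    intervalIntegral.integral_eq_sub_of_hasDerivAt_of_le hab hc hd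
      ((intervalIntegrable_iff_integrableOn_Ioc_of_le hab).2 hi)
  rw [← h1, intervalIntegral.integral_of_le hab, integral_Ioc_eq_integral_Ioo,
    ofReal_integral_eq_lintegral_ofReal (hi.mono_set Set.Ioo_subset_Ioc_self)]
  exact (ae_restrict_iff' measurableSet_Ioo).2 (Filter.Eventually.of_forall hn)

lemma split_aux (ρ : ℝ) (h0 : 0 ≤ ρ) (h1 : ρ < 1) (G : ℝ → ENNReal) :
    ∫⁻ r in Set.Ioo (0:ℝ) 1, G r =
      (∫⁻ r in Set.Ioo (0:ℝ) ρ, G r) + ∫⁻ r in Set.Ioo ρ 1, G r := by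
  rw [← Set.Ioc_union_Ioo_eq_Ioo h0 h1, lintegral_union measurableSet_Ioo]
  · congr 1
    exact setLIntegral_congr Ioo_ae_eq_Ioc.symm
  · rw [Set.disjoint_left]
    intro x hx hy
    exact absurd hy.1 (not_lt.2 hx.2)

lemma tail_aux (δ : ℝ) (hδ : -1 < δ) (ρ : ℝ) (h1 : ρ < 1) (c : ℝ) (hc : 0 ≤ c) :
    ∫⁻ r in Set.Ioo ρ 1, ENNReal.ofReal (c * ((1 - r) ^ δ * (1 - ρ) ^ (-(δ + 1)))) =
      ENNReal.ofReal (c / (δ + 1)) := by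
  have hd : 0 < δ + 1 := by linarith
  have he : 0 < 1 - ρ := by linarith
  rw [ftc_aux ρ 1 h1.le
    (fun r => - (c / (δ + 1) * (1 - ρ) ^ (-(δ + 1)) * (1 - r) ^ (δ + 1)))]
  · congr 1
    have : (1 - ρ) ^ (-(δ + 1)) * (1 - ρ) ^ (δ + 1) = 1 := by
      rw [← rpow_add he]; simp
    simp only [sub_self, zero_rpow hd.ne']
    linear_combination (c / (δ + 1)) * this
  · apply ContinuousOn.neg
    apply ContinuousOn.mul continuousOn_const
    apply ContinuousOn.rpow_const (by fun_prop)
    intro x hx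
    right; exact hd.le
  · intro x hx
    have hx' : (1 - x) ≠ 0 := by linarith [hx.2]
    have := ((((hasDerivAt_id' x).const_sub 1).rpow_const (p := δ + 1) (Or.inl hx')).const_mul
      (c / (δ + 1) * (1 - ρ) ^ (-(δ + 1)))).neg
    refine HasDerivAt.congr_deriv this ?_
    rw [add_sub_cancel_right]
    field_simp
  · intro x hx
    have : 0 < 1 - x := by linarith [hx.2]
    positivity

lemma core_aux (δ : ℝ) (hδ : -1 < δ) (ρ : ℝ) (h0 : 0 ≤ ρ) (h1 : ρ < 1) (g h H : ℝ → ℝ)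
    (c C c' M : ℝ) (hc : 0 ≤ c) (hC : 0 ≤ C) (hc' : 0 ≤ c') (hM : H ρ - H 0 = M) (hM0 : 0 ≤ M)
    (hH : ContinuousOn H (Set.Icc 0 ρ))
    (hHd : ∀ x ∈ Set.Ioo 0 ρ, HasDerivAt H (h x) x)
    (hn : ∀ x ∈ Set.Ioo 0 ρ, 0 ≤ h x)
    (hg1 : ∀ x ∈ Set.Ioo 0 ρ, c * h x ≤ g x ∧ g x ≤ C * h x)
    (hg2 : ∀ x ∈ Set.Ioo ρ 1, c' * ((1 - x) ^ δ * (1 - ρ) ^ (-(δ + 1))) ≤ g x ∧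
      g x ≤ 1 * ((1 - x) ^ δ * (1 - ρ) ^ (-(δ + 1)))) :
    ENNReal.ofReal (c * M + c' / (δ + 1)) ≤ ∫⁻ r in Set.Ioo (0:ℝ) 1, ENNReal.ofReal (g r) ∧
    ∫⁻ r in Set.Ioo (0:ℝ) 1, ENNReal.ofReal (g r) ≤ ENNReal.ofReal (C * M + 1 / (δ + 1)) := by
  have hd : 0 < δ + 1 := by linarith
  have key : ∀ a : ℝ, 0 ≤ a →
      ∫⁻ r in Set.Ioo 0 ρ, ENNReal.ofReal (a * h r) = ENNReal.ofReal (a * M) := by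
    intro a ha
    rw [ftc_aux 0 ρ h0 (fun r => a * H r) (fun r => a * h r) (continuousOn_const.mul hH)
      (fun x hx => (hHd x hx).const_mul a) (fun x hx => mul_nonneg ha (hn x hx)), ← hM]
    congr 1; ring
  rw [split_aux ρ h0 h1]
  constructor
  · rw [ENNReal.ofReal_add (by positivity) (by positivity), ← key c hc,
      ← tail_aux δ hδ ρ h1 c' hc']
    exact add_le_add
      (setLIntegral_mono' measurableSet_Ioo fun x hx => ENNReal.ofReal_le_ofReal (hg1 x hx).1)
      (setLIntegral_mono' measurableSet_Ioo fun x hx => ENNReal.ofReal_le_ofReal (hg2 x hx).1)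
  · rw [ENNReal.ofReal_add (by positivity) (by positivity), ← key C hC,
      ← tail_aux δ hδ ρ h1 1 zero_le_one]
    exact add_le_add
      (setLIntegral_mono' measurableSet_Ioo fun x hx => ENNReal.ofReal_le_ofReal (hg1 x hx).2)
      (setLIntegral_mono' measurableSet_Ioo fun x hx => ENNReal.ofReal_le_ofReal (hg2 x hx).2)

lemma head_pt (δ : ℝ) (hδ : -1 < δ) (t w : ℝ) (ht : 0 < t) (htw : t ≤ w) (hw : w ≤ 2 * t) :
    2 ^ (-(δ + 1)) * t⁻¹ ≤ t ^ δ * w ^ (-(δ + 1)) ∧ t ^ δ * w ^ (-(δ + 1)) ≤ t⁻¹ := by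
  have hd : -(δ + 1) ≤ 0 := by linarith
  have hw0 : 0 < w := by linarith
  have e : t⁻¹ = t ^ δ * t ^ (-(δ + 1)) := by
    rw [← rpow_add ht, ← rpow_neg_one]; congr 1; ring
  have a1 := rpow_le_rpow_of_nonpos ht htw hd
  have a2 := rpow_le_rpow_of_nonpos hw0 hw hd
  rw [mul_rpow (by norm_num) ht.le] at a2
  have p : 0 ≤ t ^ δ := by positivity
  constructor
  · rw [e]
    calc _ = t ^ δ * (2 ^ (-(δ + 1)) * t ^ (-(δ + 1))) := by ring
      _ ≤ _ := by gcongr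
  · rw [e]; gcongr

lemma tail_pt (δ : ℝ) (hδ : -1 < δ) (t w ε : ℝ) (ht : 0 < t) (he : 0 < ε) (hew : ε ≤ w)
    (hw : w ≤ 2 * ε) :
    2 ^ (-(δ + 1)) * (t ^ δ * ε ^ (-(δ + 1))) ≤ t ^ δ * w ^ (-(δ + 1)) ∧
      t ^ δ * w ^ (-(δ + 1)) ≤ t ^ δ * ε ^ (-(δ + 1)) := by
  have hd : -(δ + 1) ≤ 0 := by linarith
  have hw0 : 0 < w := by linarith
  have a1 := rpow_le_rpow_of_nonpos he hew hd
  have a2 := rpow_le_rpow_of_nonpos hw0 hw hd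
  rw [mul_rpow (by norm_num) he.le] at a2
  have p : 0 ≤ t ^ δ := by positivity
  constructor
  · calc _ = t ^ δ * (2 ^ (-(δ + 1)) * ε ^ (-(δ + 1))) := by ring
      _ ≤ _ := by gcongr
  · gcongr

lemma log_w (w : ℝ) (hw : 0 < w) : Real.log (Real.exp 1 / w) = 1 - Real.log w := by
  rw [Real.log_div (exp_pos _).ne' hw.ne', Real.log_exp]

lemma log_w2 (w ε : ℝ) (hw : 0 < w) (he : 0 < ε) :
    Real.log (Real.exp 1 * w / ε) = 1 + Real.log w - Real.log ε := by
  rw [Real.log_div (by positivity) he.ne', Real.log_mul (exp_pos _).ne' hw.ne', Real.log_exp]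

lemma w_facts (ρ r : ℝ) (h0 : 0 ≤ ρ) (h1 : ρ < 1) (r0 : 0 ≤ r) (r1 : r < 1) :
    1 - r ≤ 1 - ρ * r ∧ 1 - ρ ≤ 1 - ρ * r ∧ 1 - ρ * r ≤ (1 - ρ) + (1 - r) ∧ 1 - ρ * r ≤ 1 := by
  refine ⟨?_, ?_, ?_, ?_⟩ <;> nlinarith [mul_nonneg h0 r0, mul_nonneg (sub_nonneg.2 h1.le) (sub_nonneg.2 r1.le)]

lemma prod_bd (a b x y z u : ℝ) (ha : 0 ≤ a) (hx : 0 ≤ x) (hab : a ≤ b) (hxy : x ≤ y)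
    (hz : z = a * x) (hu : u = b * y) : z ≤ u := by
  subst hz hu
  exact mul_le_mul hab hxy hx (ha.trans hab)

lemma I1_bd (δ : ℝ) (hδ : -1 < δ) (ρ : ℝ) (h0 : 0 ≤ ρ) (h1 : ρ < 1) :
    ENNReal.ofReal (2 ^ (-(δ + 1)) * Real.log (1 - Real.log (1 - ρ)) +
        2 ^ (-(δ + 1)) * (1 - Real.log (1 - ρ))⁻¹ / (δ + 1)) ≤
      ∫⁻ r in Set.Ioo (0:ℝ) 1, ENNReal.ofReal ((1 - r) ^ δ * (1 - r * ρ) ^ (-(δ + 1)) *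
              (Real.log (Real.exp 1 / (1 - ρ * r)))⁻¹) ∧
    ∫⁻ r in Set.Ioo (0:ℝ) 1, ENNReal.ofReal ((1 - r) ^ δ * (1 - r * ρ) ^ (-(δ + 1)) *
              (Real.log (Real.exp 1 / (1 - ρ * r)))⁻¹) ≤
      ENNReal.ofReal (4 * Real.log (1 - Real.log (1 - ρ)) + 1 / (δ + 1)) := by
  have he : 0 < 1 - ρ := by linarith
  have hL : Real.log (1 - ρ) ≤ 0 := Real.log_nonpos he.le (by linarith)
  have hk : (0:ℝ) < 2 ^ (-(δ + 1)) := by positivity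
  have hl2 := Real.log_two_lt_d9
  apply core_aux δ hδ ρ h0 h1 _ (fun r => (1 - r)⁻¹ * (1 - Real.log (1 - r))⁻¹)
    (fun r => Real.log (1 - Real.log (1 - r))) _ _ _ _ hk.le (by norm_num)
  · have : 0 < 1 - Real.log (1 - ρ) := by linarith
    positivity
  · simp
  · exact Real.log_nonneg (by linarith)
  · intro x hx
    have t0 : 0 < 1 - x := by linarith [hx.2]
    have : Real.log (1 - x) ≤ 0 := Real.log_nonpos t0.le (by linarith [hx.1])
    have a1 : (1 - x) ≠ 0 := t0.ne'
    have a2 : 1 - Real.log (1 - x) ≠ 0 := by linarith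
    exact ContinuousAt.continuousWithinAt (by fun_prop (disch := assumption))
  · intro x hx
    have t0 : 0 < 1 - x := by linarith [hx.2]
    have : Real.log (1 - x) ≤ 0 := Real.log_nonpos t0.le (by linarith [hx.1])
    have a2 : 1 - Real.log (1 - x) ≠ 0 := by linarith
    have := ((((hasDerivAt_id' x).const_sub 1).log t0.ne').const_sub 1).log a2
    refine HasDerivAt.congr_deriv this ?_
    field_simp
  · intro x hx
    have t0 : 0 < 1 - x := by linarith [hx.2]
    have : Real.log (1 - x) ≤ 0 := Real.log_nonpos t0.le (by linarith [hx.1])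
    have a2 : 0 < 1 - Real.log (1 - x) := by linarith
    positivity
  · intro x hx
    have t0 : 0 < 1 - x := by linarith [hx.2]
    obtain ⟨f1, f2, f3, f4⟩ := w_facts ρ x h0 h1 hx.1.le (by linarith)
    have w0 : 0 < 1 - ρ * x := by linarith
    have w2 : 1 - ρ * x ≤ 2 * (1 - x) := by linarith [hx.2]
    obtain ⟨p1, p2⟩ := head_pt δ hδ (1 - x) (1 - ρ * x) t0 f1 w2
    rw [log_w _ w0, mul_comm x ρ]
    have l1 := Real.log_le_log t0 f1
    have l2 := Real.log_le_log w0 w2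
    rw [Real.log_mul (by norm_num) t0.ne'] at l2
    have l3 : Real.log (1 - ρ * x) ≤ 0 := Real.log_nonpos w0.le f4
    have q1 : 0 < 1 - Real.log (1 - x) := by linarith
    have q2 : 0 < 1 - Real.log (1 - ρ * x) := by linarith
    have j1 : (1 - Real.log (1 - x))⁻¹ ≤ (1 - Real.log (1 - ρ * x))⁻¹ :=
      inv_anti₀ q2 (by linarith)
    have j2 : (1 - Real.log (1 - ρ * x))⁻¹ ≤ 4 * (1 - Real.log (1 - x))⁻¹ := by
      rw [← div_eq_mul_inv, inv_eq_one_div, div_le_div_iff₀ q2 q1]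
      linarith
    constructor
    · exact prod_bd _ _ _ _ _ _ (by positivity) (by positivity) p1 j1 (by ring) rfl
    · exact prod_bd _ _ _ _ _ _ (by positivity) (by positivity) p2 j2 rfl (by ring)
  · intro x hx
    have t0 : 0 < 1 - x := by linarith [hx.2]
    obtain ⟨f1, f2, f3, f4⟩ := w_facts ρ x h0 h1 (by linarith [hx.1]) hx.2
    have w0 : 0 < 1 - ρ * x := by linarith
    have w2 : 1 - ρ * x ≤ 2 * (1 - ρ) := by linarith [hx.1]
    obtain ⟨p1, p2⟩ := tail_pt δ hδ (1 - x) (1 - ρ * x) (1 - ρ) t0 he f2 w2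
    rw [log_w _ w0, mul_comm x ρ]
    have l1 := Real.log_le_log he f2
    have l3 : Real.log (1 - ρ * x) ≤ 0 := Real.log_nonpos w0.le f4
    have q1 : 0 < 1 - Real.log (1 - ρ) := by linarith
    have q2 : 0 < 1 - Real.log (1 - ρ * x) := by linarith
    have j1 : (1 - Real.log (1 - ρ))⁻¹ ≤ (1 - Real.log (1 - ρ * x))⁻¹ :=
      inv_anti₀ q2 (by linarith)
    have j2 : (1 - Real.log (1 - ρ * x))⁻¹ ≤ 1 := inv_le_one_of_one_le₀ (by linarith)
    constructor
    · exact prod_bd _ _ _ _ _ _ (by positivity) (by positivity) p1 j1 (by ring) rfl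
    · exact prod_bd _ _ _ _ _ _ (by positivity) (by positivity) p2 j2 rfl (by ring)

lemma I2_bd (δ : ℝ) (hδ : -1 < δ) (ρ : ℝ) (h0 : 0 ≤ ρ) (h1 : ρ < 1) :
    ENNReal.ofReal (2 ^ (-(δ + 1)) / 2 * Real.log (1 - Real.log (1 - ρ)) +
        2 ^ (-(δ + 1)) / 2 / (δ + 1)) ≤
      ∫⁻ r in Set.Ioo (0:ℝ) 1, ENNReal.ofReal ((1 - r) ^ δ * (1 - r * ρ) ^ (-(δ + 1)) *
              (Real.log (Real.exp 1 * (1 - ρ * r) / (1 - ρ)))⁻¹) ∧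
    ∫⁻ r in Set.Ioo (0:ℝ) 1, ENNReal.ofReal ((1 - r) ^ δ * (1 - r * ρ) ^ (-(δ + 1)) *
              (Real.log (Real.exp 1 * (1 - ρ * r) / (1 - ρ)))⁻¹) ≤
      ENNReal.ofReal (1 * Real.log (1 - Real.log (1 - ρ)) + 1 / (δ + 1)) := by
  have he : 0 < 1 - ρ := by linarith
  have hL : Real.log (1 - ρ) ≤ 0 := Real.log_nonpos he.le (by linarith)
  have hk : (0:ℝ) < 2 ^ (-(δ + 1)) := by positivity
  have hl2 := Real.log_two_lt_d9
  apply core_aux δ hδ ρ h0 h1 _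
    (fun r => (1 - r)⁻¹ * (1 + Real.log (1 - r) - Real.log (1 - ρ))⁻¹)
    (fun r => - Real.log (1 + Real.log (1 - r) - Real.log (1 - ρ))) _ _ _ _
    (by positivity) (by norm_num)
  · positivity
  · simp
  · exact Real.log_nonneg (by linarith)
  · intro x hx
    have t0 : 0 < 1 - x := by linarith [hx.2]
    have := Real.log_le_log he (show 1 - ρ ≤ 1 - x by linarith [hx.2])
    have a1 : (1 - x) ≠ 0 := t0.ne'
    have a2 : 1 + Real.log (1 - x) - Real.log (1 - ρ) ≠ 0 := by linarith
    exact ContinuousAt.continuousWithinAt (by fun_prop (disch := assumption))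
  · intro x hx
    have t0 : 0 < 1 - x := by linarith [hx.2]
    have := Real.log_le_log he (show 1 - ρ ≤ 1 - x by linarith [hx.2])
    have a2 : 1 + Real.log (1 - x) - Real.log (1 - ρ) ≠ 0 := by linarith
    have := (((((hasDerivAt_id' x).const_sub 1).log t0.ne').const_add 1).sub_const
      (Real.log (1 - ρ))).log a2 |>.neg
    refine HasDerivAt.congr_deriv this ?_
    field_simp
  · intro x hx
    have t0 : 0 < 1 - x := by linarith [hx.2]
    have := Real.log_le_log he (show 1 - ρ ≤ 1 - x by linarith [hx.2])
    have a2 : 0 < 1 + Real.log (1 - x) - Real.log (1 - ρ) := by linarith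
    positivity
  · intro x hx
    have t0 : 0 < 1 - x := by linarith [hx.2]
    have l0 := Real.log_le_log he (show 1 - ρ ≤ 1 - x by linarith [hx.2])
    obtain ⟨f1, f2, f3, f4⟩ := w_facts ρ x h0 h1 hx.1.le (by linarith)
    have w0 : 0 < 1 - ρ * x := by linarith
    have w2 : 1 - ρ * x ≤ 2 * (1 - x) := by linarith [hx.2]
    obtain ⟨p1, p2⟩ := head_pt δ hδ (1 - x) (1 - ρ * x) t0 f1 w2
    rw [log_w2 _ _ w0 he, mul_comm x ρ]
    have l1 := Real.log_le_log t0 f1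
    have l2 := Real.log_le_log w0 w2
    rw [Real.log_mul (by norm_num) t0.ne'] at l2
    have q1 : 0 < 1 + Real.log (1 - x) - Real.log (1 - ρ) := by linarith
    have q2 : 0 < 1 + Real.log (1 - ρ * x) - Real.log (1 - ρ) := by linarith
    have j2 : (1 + Real.log (1 - ρ * x) - Real.log (1 - ρ))⁻¹ ≤
        (1 + Real.log (1 - x) - Real.log (1 - ρ))⁻¹ :=
      inv_anti₀ q1 (by linarith)
    have j1 : (1 + Real.log (1 - x) - Real.log (1 - ρ))⁻¹ / 2 ≤
        (1 + Real.log (1 - ρ * x) - Real.log (1 - ρ))⁻¹ := by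
      rw [div_eq_mul_inv, ← mul_inv]
      exact inv_anti₀ q2 (by linarith)
    constructor
    · exact prod_bd _ _ _ _ _ _ (by positivity) (by positivity) p1 j1 (by ring) rfl
    · exact prod_bd _ _ _ _ _ _ (by positivity) (by positivity) p2 j2 rfl (by ring)
  · intro x hx
    have t0 : 0 < 1 - x := by linarith [hx.2]
    obtain ⟨f1, f2, f3, f4⟩ := w_facts ρ x h0 h1 (by linarith [hx.1]) hx.2
    have w0 : 0 < 1 - ρ * x := by linarith
    have w2 : 1 - ρ * x ≤ 2 * (1 - ρ) := by linarith [hx.1]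
    obtain ⟨p1, p2⟩ := tail_pt δ hδ (1 - x) (1 - ρ * x) (1 - ρ) t0 he f2 w2
    rw [log_w2 _ _ w0 he, mul_comm x ρ]
    have l1 := Real.log_le_log he f2
    have l2 := Real.log_le_log w0 w2
    rw [Real.log_mul (by norm_num) he.ne'] at l2
    have q2 : 0 < 1 + Real.log (1 - ρ * x) - Real.log (1 - ρ) := by linarith
    have j1 : (2:ℝ)⁻¹ ≤ (1 + Real.log (1 - ρ * x) - Real.log (1 - ρ))⁻¹ :=
      inv_anti₀ q2 (by linarith)
    have j2 : (1 + Real.log (1 - ρ * x) - Real.log (1 - ρ))⁻¹ ≤ 1 :=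
      inv_le_one_of_one_le₀ (by linarith)
    constructor
    · exact prod_bd _ _ _ _ _ _ (by positivity) (by positivity) p1 j1 (by ring) rfl
    · exact prod_bd _ _ _ _ _ _ (by positivity) (by positivity) p2 j2 rfl (by ring)

/-- **Lemma 2.1 (4).** For `δ > -1`, `c = 0` and `k = -1`,
`I₁(ρ) = ∫₀¹ (1-r)^δ (1-rρ)^{-(δ+1)} (log(e/(1-ρr)))^{-1} dr` and
`I₂(ρ) = ∫₀¹ (1-r)^δ (1-rρ)^{-(δ+1)} (log(e(1-ρr)/(1-ρ)))^{-1} dr`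
are both comparable to `log log (e²/(1-ρ))` uniformly for `ρ ∈ [0,1)`. -/
theorem lemma21_case4 (δ : ℝ) (hδ : -1 < δ) :
    ∃ A₁ A₂ : ℝ, 0 < A₁ ∧ 0 < A₂ ∧ ∀ ρ : ℝ, 0 ≤ ρ → ρ < 1 →
      (ENNReal.ofReal (A₁ * Real.log (Real.log (Real.exp 1 ^ (2:ℕ) / (1 - ρ)))) ≤
          ∫⁻ r in Set.Ioo (0:ℝ) 1,
            ENNReal.ofReal ((1 - r) ^ δ * (1 - r * ρ) ^ (-(δ + 1)) *
              (Real.log (Real.exp 1 / (1 - ρ * r)))⁻¹)) ∧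
      ((∫⁻ r in Set.Ioo (0:ℝ) 1,
            ENNReal.ofReal ((1 - r) ^ δ * (1 - r * ρ) ^ (-(δ + 1)) *
              (Real.log (Real.exp 1 / (1 - ρ * r)))⁻¹)) ≤
        ENNReal.ofReal (A₂ * Real.log (Real.log (Real.exp 1 ^ (2:ℕ) / (1 - ρ))))) ∧
      (ENNReal.ofReal (A₁ * Real.log (Real.log (Real.exp 1 ^ (2:ℕ) / (1 - ρ)))) ≤
          ∫⁻ r in Set.Ioo (0:ℝ) 1,
            ENNReal.ofReal ((1 - r) ^ δ * (1 - r * ρ) ^ (-(δ + 1)) *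
              (Real.log (Real.exp 1 * (1 - ρ * r) / (1 - ρ)))⁻¹)) ∧
      ((∫⁻ r in Set.Ioo (0:ℝ) 1,
            ENNReal.ofReal ((1 - r) ^ δ * (1 - r * ρ) ^ (-(δ + 1)) *
              (Real.log (Real.exp 1 * (1 - ρ * r) / (1 - ρ)))⁻¹)) ≤
        ENNReal.ofReal (A₂ * Real.log (Real.log (Real.exp 1 ^ (2:ℕ) / (1 - ρ))))) := by
  have hd : 0 < δ + 1 := by linarith
  have hk : (0:ℝ) < 2 ^ (-(δ + 1)) := by positivity
  set k : ℝ := 2 ^ (-(δ + 1)) with hkdef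
  have hm : 0 < min 1 (1 / (δ + 1)) := lt_min one_pos (by positivity)
  set m : ℝ := min 1 (1 / (δ + 1)) with hmdef
  have m1 : m ≤ 1 := min_le_left _ _
  have m2 : m ≤ 1 / (δ + 1) := min_le_right _ _
  refine ⟨k / 2 * m, 4 + 2 * (1 / (δ + 1)), by positivity, by positivity, ?_⟩
  intro ρ h0 h1
  have he : 0 < 1 - ρ := by linarith
  have hL : Real.log (1 - ρ) ≤ 0 := Real.log_nonpos he.le (by linarith)
  obtain ⟨a1, a2⟩ := I1_bd δ hδ ρ h0 h1
  obtain ⟨b1, b2⟩ := I2_bd δ hδ ρ h0 h1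
  have e : Real.log (Real.exp 1 ^ (2:ℕ) / (1 - ρ)) = 1 + (1 - Real.log (1 - ρ)) := by
    rw [Real.log_div (by positivity) he.ne', Real.log_pow, Real.log_exp]
    push_cast; ring
  rw [e]
  set y : ℝ := 1 - Real.log (1 - ρ) with hy
  have y1 : 1 ≤ y := by linarith
  have y0 : 0 < y := by linarith
  have yi : 0 < y⁻¹ := by positivity
  have yi1 : y⁻¹ ≤ 1 := inv_le_one_of_one_le₀ y1
  have ly : 0 ≤ Real.log y := Real.log_nonneg y1
  have ly2 : Real.log y ≤ Real.log (1 + y) := Real.log_le_log y0 (by linarith)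
  have ly3 : 1 / 2 ≤ Real.log (1 + y) := by
    have := Real.log_le_log (by norm_num) (show (2:ℝ) ≤ 1 + y by linarith)
    linarith [Real.log_two_gt_d9]
  have ly4 : Real.log (1 + y) ≤ Real.log y + y⁻¹ := by
    have : 1 + y = y * (1 + y⁻¹) := by field_simp; ring
    rw [this, Real.log_mul y0.ne' (by positivity)]
    have := Real.log_le_sub_one_of_pos (show 0 < 1 + y⁻¹ by positivity)
    linarith
  have lm : m * Real.log (1 + y) ≤ Real.log y + y⁻¹ * (1 / (δ + 1)) := by
    calc m * Real.log (1 + y) ≤ m * (Real.log y + y⁻¹) := by gcongr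
      _ = m * Real.log y + y⁻¹ * m := by ring
      _ ≤ 1 * Real.log y + y⁻¹ * (1 / (δ + 1)) := by gcongr
      _ = _ := by ring
  have hi : 0 < 1 / (δ + 1) := by positivity
  have up : 1 / (δ + 1) ≤ 2 * (1 / (δ + 1)) * Real.log (1 + y) := by nlinarith
  have r0 : 0 ≤ Real.log y + y⁻¹ * (1 / (δ + 1)) := by positivity
  have lk := mul_le_mul_of_nonneg_left lm (show 0 ≤ k / 2 by positivity)
  refine ⟨le_trans (ENNReal.ofReal_le_ofReal ?_) a1, a2.trans (ENNReal.ofReal_le_ofReal ?_),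
    le_trans (ENNReal.ofReal_le_ofReal ?_) b1, b2.trans (ENNReal.ofReal_le_ofReal ?_)⟩
  · have : k * Real.log y + k * y⁻¹ / (δ + 1) = k * (Real.log y + y⁻¹ * (1 / (δ + 1))) := by ring
    rw [this]
    nlinarith
  · linarith
  · have h3 : k / 2 * Real.log y + k / 2 / (δ + 1) = k / 2 * (Real.log y + 1 * (1 / (δ + 1))) := by
      ring
    rw [h3]
    have : k / 2 * (Real.log y + y⁻¹ * (1 / (δ + 1))) ≤ k / 2 * (Real.log y + 1 * (1 / (δ + 1))) := by
      gcongr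
    linarith
  · linarith
end
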